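/- For the function g(x) = log(1 + log(1 + x)) defined on [0, ∞), for all x, y ≥ 0 one has g(x·y) + g(x + y) ≤ 2·(g(x) + g(y)). -/

import Mathlib

/-- For `g(x) = log(1 + log(1 + x))` and all `x, y ≥ 0`,
`g(x·y) + g(x + y) ≤ 2·(g(x) + g(y))`. -/
theorem stmt_0 (g : ℝ → ℝ) (hg : ∀ x, g x = Real.log (1 + Real.log (1 + x)))
    (x y : ℝ) (hx : 0 ≤ x) (hy : 0 ≤ y) :
    g (x * y) + g (x + y) ≤ 2 * (g x + g y) := by
  have hxy : 0 ≤ x * y := mul_nonneg hx hy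
  have ha : 0 ≤ Real.log (1 + x) := Real.log_nonneg (by linarith)
  have hb : 0 ≤ Real.log (1 + y) := Real.log_nonneg (by linarith)
  have key : ∀ z, 0 ≤ z → 1 + z ≤ (1 + x) * (1 + y) → g z ≤ g x + g y := by
    intro z hz h
    have hc : 0 ≤ Real.log (1 + z) := Real.log_nonneg (by linarith)
    have hlog : Real.log (1 + z) ≤ Real.log (1 + x) + Real.log (1 + y) := by
      rw [← Real.log_mul (by positivity) (by positivity)]
      exact Real.log_le_log (by positivity) h
    rw [hg, hg, hg, ← Real.log_mul (by positivity) (by positivity)]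
    exact Real.log_le_log (by positivity) (by nlinarith [mul_nonneg ha hb])
  linarith [key (x * y) hxy (by linarith), key (x + y) (by positivity) (by linarith)]
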